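/- arXiv:2503.13727 — 2 statements merged into one kernel-verified Lean document; each statement's English description precedes it below -/
import Mathlib

section
/- For every computable linear order L, the ill-founded part of L, namely I(L) = {a : there exists a descending sequence f in L with f(0) = a}, is not Σ¹₁-complete: although I(L) is Σ¹₁, there exists a Σ¹₁ set A ⊆ ℕ that is not many-one reducible to I(L). -/
namespace CFT

open Nat.Partrec (Code)

/-- Relativized partial recursive functions: `f` is partial recursive in the
(total) oracle `O : ℕ → ℕ`.  This mirrors Mathlib's `Nat.Partrec`, with an
extra constructor for the oracle. -/
inductive RecursiveIn (O : ℕ → ℕ) : (ℕ →. ℕ) → Prop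
  | zero : RecursiveIn O (pure 0)
  | succ : RecursiveIn O Nat.succ
  | left : RecursiveIn O ↑fun n : ℕ => n.unpair.1
  | right : RecursiveIn O ↑fun n : ℕ => n.unpair.2
  | oracle : RecursiveIn O ↑O
  | pair {f g} : RecursiveIn O f → RecursiveIn O g →
      RecursiveIn O fun n => Nat.pair <$> f n <*> g n
  | comp {f g} : RecursiveIn O f → RecursiveIn O g →
      RecursiveIn O fun n => g n >>= f
  | prec {f g} : RecursiveIn O f → RecursiveIn O g →
      RecursiveIn O (Nat.unpaired fun a n =>
        n.rec (f a) fun y IH => do let i ← IH; g (Nat.pair a (Nat.pair y i)))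
  | rfind {f} : RecursiveIn O f →
      RecursiveIn O fun a => Nat.rfind fun n => (fun m => m = 0) <$> f (Nat.pair a n)

/-- Partial functions between `Primcodable` types that are partial recursive in
the oracle `O`. -/
def PartrecIn (O : ℕ → ℕ) {α σ : Type} [Primcodable α] [Primcodable σ] (f : α →. σ) : Prop :=
  RecursiveIn O fun n =>
    Part.bind (Part.ofOption (Encodable.decode (α := α) n)) fun a => (f a).map Encodable.encode

/-- Total functions between `Primcodable` types that are computable in the oracle `O`. -/
def ComputableIn (O : ℕ → ℕ) {α σ : Type} [Primcodable α] [Primcodable σ] (f : α → σ) : Prop :=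
  PartrecIn O (f : α →. σ)

open Classical in
/-- The characteristic function of a set of naturals. -/
noncomputable def chi (A : Set ℕ) : ℕ → ℕ := fun n => if n ∈ A then 1 else 0

/-- `A` is computably enumerable in (the characteristic function of) `X`. -/
def CEIn (X : Set ℕ) (A : Set ℕ) : Prop :=
  ∃ f : ℕ →. ℕ, PartrecIn (chi X) f ∧ ∀ n, n ∈ A ↔ (f n).Dom

/-- The `e`-th partial computable function `ℕ →. ℕ`. -/
def codeFn (e : ℕ) : ℕ →. ℕ := (Denumerable.ofNat Code e).eval

/-! ### Trees on ℕ -/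

def PrefixClosed (T : Set (List ℕ)) : Prop := ∀ l ∈ T, ∀ l' : List ℕ, l' <+: l → l' ∈ T

/-- Index `e` decides a (prefix-closed) tree on `ℕ`. -/
def DecidesTree (e : ℕ) : Prop :=
  (∀ n, (codeFn e n).Dom) ∧
    PrefixClosed {l : List ℕ | codeFn e (Encodable.encode l) = Part.some 1}

open Classical in
/-- The standard enumeration of computable trees on ℕ; indices that do not
decide a tree denote the empty tree. -/
noncomputable def treeAt (e : ℕ) : Set (List ℕ) :=
  if DecidesTree e then {l : List ℕ | codeFn e (Encodable.encode l) = Part.some 1} else ∅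

/-- `f` is a path through the tree `T`: every finite initial segment
`[f 0, …, f (k-1)]` is in `T`. -/
def IsPath (T : Set (List ℕ)) (f : ℕ → ℕ) : Prop := ∀ k, (List.range k).map f ∈ T

def IllFounded (T : Set (List ℕ)) : Prop := ∃ f, IsPath T f

/-- The set of indices of well-founded computable trees. -/
def WF : Set ℕ := {e | ¬ IllFounded (treeAt e)}

/-- `T` is a computable tree (prefix-closed and decided by a total computable function). -/
def ComputableTree (T : Set (List ℕ)) : Prop :=
  PrefixClosed T ∧ ∃ χ : List ℕ → Bool, Computable χ ∧ ∀ l, l ∈ T ↔ χ l = true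

/-! ### Highness notions for paths -/

def HighForPaths (X : Set ℕ) : Prop :=
  ∀ T : Set (List ℕ), ComputableTree T → IllFounded T →
    ∃ f : ℕ → ℕ, ComputableIn (chi X) f ∧ IsPath T f

def LoqHighForPaths (X : Set ℕ) : Prop :=
  ∃ F : ℕ × ℕ → ℕ, ComputableIn (chi X) F ∧
    ∀ e, IllFounded (treeAt e) → IsPath (treeAt e) fun n => F (e, n)

def UnifHighForPaths (X : Set ℕ) : Prop :=
  ∃ F : ℕ × ℕ →. ℕ, PartrecIn (chi X) F ∧
    ∀ e, IllFounded (treeAt e) →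
      ∃ g : ℕ → ℕ, IsPath (treeAt e) g ∧ ∀ n, F (e, n) = Part.some (g n)

def RetHighForPaths (X : Set ℕ) : Prop :=
  ∃ F : ℕ × ℕ →. ℕ, PartrecIn (chi X) F ∧
    (∀ e, IllFounded (treeAt e) →
      ∃ g : ℕ → ℕ, IsPath (treeAt e) g ∧ ∀ n, F (e, n) = Part.some (g n)) ∧
    (∀ e, ¬ IllFounded (treeAt e) → ∀ n, ¬ (F (e, n)).Dom)

/-! ### Σ¹₁ and Π¹₁ sets -/

def Sigma11 (A : Set ℕ) : Prop :=
  ∃ R : ℕ → List ℕ → Bool, Computable₂ R ∧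
    ∀ n, n ∈ A ↔ ∃ f : ℕ → ℕ, ∀ k, R n ((List.range k).map f) = true

def Pi11 (A : Set ℕ) : Prop := Sigma11 Aᶜ

/-! ### Linear orders -/

/-- A (presentation of a) linear order: a domain `D ⊆ ℕ` and a strict order
relation on it. -/
structure LinOrd where
  dom : Set ℕ
  lt : ℕ → ℕ → Prop

/-- `L` really is a strict linear order on its domain. -/
def LinOrd.IsValid (L : LinOrd) : Prop :=
  (∀ a b, L.lt a b → a ∈ L.dom ∧ b ∈ L.dom) ∧
  (∀ a, ¬ L.lt a a) ∧
  (∀ a b c, L.lt a b → L.lt b c → L.lt a c) ∧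
  (∀ a ∈ L.dom, ∀ b ∈ L.dom, a = b ∨ L.lt a b ∨ L.lt b a)

def linOrdOfCodes (n : ℕ) : LinOrd :=
  ⟨{a | codeFn n.unpair.1 a = Part.some 1},
   fun a b => codeFn n.unpair.2 (Nat.pair a b) = Part.some 1⟩

def DecidesLinOrd (n : ℕ) : Prop :=
  (∀ m, (codeFn n.unpair.1 m).Dom) ∧ (∀ m, (codeFn n.unpair.2 m).Dom) ∧
    (linOrdOfCodes n).IsValid

open Classical in
/-- The standard enumeration of computable linear orders; indices that do not
decide a linear order denote the empty order. -/
noncomputable def linOrdAt (n : ℕ) : LinOrd :=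
  if DecidesLinOrd n then linOrdOfCodes n else ⟨∅, fun _ _ => False⟩

def IsDescSeq (L : LinOrd) (f : ℕ → ℕ) : Prop :=
  ∀ i, f i ∈ L.dom ∧ L.lt (f (i + 1)) (f i)

def LinOrd.IllFounded (L : LinOrd) : Prop := ∃ f, IsDescSeq L f

/-- A tight descending sequence: a descending sequence that gets below every
descending sequence. -/
def IsTightDescSeq (L : LinOrd) (f : ℕ → ℕ) : Prop :=
  IsDescSeq L f ∧ ∀ g, IsDescSeq L g → ∀ n, ∃ m, L.lt (f m) (g n)

/-- `L` is a computable linear order. -/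
def ComputableLinOrd (L : LinOrd) : Prop :=
  L.IsValid ∧
  (∃ χ : ℕ → Bool, Computable χ ∧ ∀ a, a ∈ L.dom ↔ χ a = true) ∧
  (∃ χ : ℕ → ℕ → Bool, Computable₂ χ ∧ ∀ a b, L.lt a b ↔ χ a b = true)

def LoqHighForDS (X : Set ℕ) : Prop :=
  ∃ g : ℕ × ℕ → ℕ, ComputableIn (chi X) g ∧
    ∀ n, (linOrdAt n).IllFounded → IsDescSeq (linOrdAt n) fun k => g (n, k)

def HighForTightDS (X : Set ℕ) : Prop :=
  ∀ L : LinOrd, ComputableLinOrd L → L.IllFounded →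
    ∃ f : ℕ → ℕ, ComputableIn (chi X) f ∧ IsTightDescSeq L f

def UnifHighForTightDS (X : Set ℕ) : Prop :=
  ∃ F : ℕ × ℕ →. ℕ, PartrecIn (chi X) F ∧
    ∀ n, (linOrdAt n).IllFounded →
      ∃ g : ℕ → ℕ, IsTightDescSeq (linOrdAt n) g ∧ ∀ k, F (n, k) = Part.some (g k)

/-! ### Binary trees -/

def PrefixClosedB (B : Set (List Bool)) : Prop := ∀ l ∈ B, ∀ l' : List Bool, l' <+: l → l' ∈ B

def DecidesBTree (e : ℕ) : Prop :=
  (∀ n, (codeFn e n).Dom) ∧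
    PrefixClosedB {l : List Bool | codeFn e (Encodable.encode l) = Part.some 1}

open Classical in
/-- The standard enumeration of computable binary trees; indices that do not
decide a binary tree denote the full binary tree. -/
noncomputable def bTreeAt (e : ℕ) : Set (List Bool) :=
  if DecidesBTree e then {l : List Bool | codeFn e (Encodable.encode l) = Part.some 1}
  else Set.univ

def BInfinite (B : Set (List Bool)) : Prop := ∀ k, ∃ l ∈ B, l.length = k

def IsBPath (B : Set (List Bool)) (p : ℕ → Bool) : Prop := ∀ k, (List.range k).map p ∈ B


/-- The ill-founded part of a linear order: the elements starting some descending
sequence. -/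
def illPart (L : LinOrd) : Set ℕ := {a | ∃ f : ℕ → ℕ, IsDescSeq L f ∧ f 0 = a}

/-- The ill-founded part of a computable linear order is `Σ¹₁`. -/
theorem sigma11_illPart {L : LinOrd} (hL : ComputableLinOrd L) : Sigma11 (illPart L) := by
  obtain ⟨hv, -, χ, hχ, hlt⟩ := hL
  refine ⟨fun n l => decide (l.length < 2) ||
    (χ (l.getI (l.length - 1)) (l.getI (l.length - 2)) && decide (l.getI 0 = n)), ?_, ?_⟩
  · have hlen : Computable fun p : ℕ × List ℕ => p.2.length :=
      Computable.list_length.comp Computable.snd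
    have hget {i : ℕ × List ℕ → ℕ} (hi : Computable i) :
        Computable fun p : ℕ × List ℕ => p.2.getI (i p) :=
      Computable₂.comp (Primrec.list_getI.to_comp) Computable.snd hi
    have hsub (c : ℕ) : Computable fun p : ℕ × List ℕ => p.2.length - c :=
      Computable₂.comp Primrec.nat_sub.to_comp hlen (Computable.const c)
    have hlast : Computable fun p : ℕ × List ℕ =>
        χ (p.2.getI (p.2.length - 1)) (p.2.getI (p.2.length - 2)) :=
      hχ.comp (hget (hsub 1)) (hget (hsub 2))
    have hshort : Computable fun p : ℕ × List ℕ => decide (p.2.length < 2) :=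
      Computable₂.comp (Primrec.nat_lt.decide.to_comp) hlen (Computable.const 2)
    have hhead : Computable fun p : ℕ × List ℕ => decide (p.2.getI 0 = p.1) :=
      Computable₂.comp (Primrec.eq.decide.to_comp) (hget (Computable.const 0)) Computable.fst
    exact Computable₂.comp Primrec.or.to_comp hshort
      (Computable₂.comp Primrec.and.to_comp hlast hhead)
  · have hget (f : ℕ → ℕ) {i k : ℕ} (h : i < k) : ((List.range k).map f).getI i = f i := by
      rw [List.getI_eq_getElem _ (by simpa using h)]
      simp
    refine fun n => exists_congr fun f => ⟨?_, fun h => ⟨fun i => ?_, ?_⟩⟩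
    · rintro ⟨hf, h0⟩ k
      rcases lt_or_ge k 2 with hk | hk
      · simp [hk]
      · obtain ⟨m, rfl⟩ := Nat.exists_eq_add_of_le' hk
        have := (hlt _ _).1 (hf m).2
        simp [hget, this, h0]
    · have hi := h (i + 2)
      simp [hget, ← hlt] at hi
      exact ⟨(hv.1 _ _ hi.1).2, hi.1⟩
    · have h2 := h 2
      simp only [hget f two_pos, List.length_map, List.length_range] at h2
      simp at h2
      exact h2.2

/-- The ill-founded part of a linear order is upward closed. -/
theorem mem_illPart_of_lt {L : LinOrd} (hL : L.IsValid) {a b : ℕ} (hab : L.lt a b)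
    (ha : a ∈ illPart L) : b ∈ illPart L := by
  obtain ⟨f, hf, rfl⟩ := ha
  refine ⟨fun i => i.casesOn b f, ?_, rfl⟩
  rintro (_ | i)
  · exact ⟨(hL.1 _ _ hab).2, hab⟩
  · exact hf i

theorem illPart_subset_dom (L : LinOrd) : illPart L ⊆ L.dom := by
  rintro _ ⟨f, hf, rfl⟩
  exact (hf 0).1

/-- The set of programs that output `v` on their own index is `Σ¹₁`. -/
theorem sigma11_self_output (v : ℕ) : Sigma11 {n | v ∈ codeFn n n} := by
  refine ⟨fun n l => decide (l.length = 0) ||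
    decide (Code.evaln (l.getI 0) (Denumerable.ofNat Code n) n = some v), ?_, fun n => ?_⟩
  · have heval : Primrec fun p : ℕ × List ℕ =>
        Code.evaln (p.2.getI 0) (Denumerable.ofNat Code p.1) p.1 :=
      Code.primrec_evaln.comp
        (((Primrec.list_getI.comp Primrec.snd (Primrec.const 0)).pair
          ((Primrec.ofNat Code).comp Primrec.fst)).pair Primrec.fst)
    have hempty : Primrec fun p : ℕ × List ℕ => decide (p.2.length = 0) :=
      Primrec.eq.decide.comp (Primrec.list_length.comp Primrec.snd) (Primrec.const 0)
    exact (Primrec.or.comp hempty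
      (Primrec.eq.decide.comp heval (Primrec.const (some v)))).to_comp
  · rw [Set.mem_ofPred_eq, codeFn, Code.evaln_complete]
    constructor
    · rintro ⟨k, hk⟩
      refine ⟨fun _ => k, ?_⟩
      rintro (_ | m)
      · simp
      · simpa [List.range_succ_eq_map] using hk
    · rintro ⟨f, hf⟩
      exact ⟨f 0, by simpa [List.range_succ_eq_map] using hf 1⟩

/-- No computable set separates the programs outputting `0` on their own index from those
outputting `1`. -/
theorem not_computable_separation {g : ℕ → Bool} (hg : Computable g)
    (h0 : ∀ n, 0 ∈ codeFn n n → g n = true) (h1 : ∀ n, 1 ∈ codeFn n n → g n = false) :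
    False := by
  have hd : Computable fun n => (g n).toNat :=
    (Primrec.dom_finite Bool.toNat).to_comp.comp hg
  obtain ⟨c, hc⟩ := Code.exists_code.1 (Partrec.nat_iff.1 hd)
  have hn : codeFn (Encodable.encode c) (Encodable.encode c) =
      Part.some (g (Encodable.encode c)).toNat := by
    rw [codeFn, Denumerable.ofNat_encode, hc]
    rfl
  cases h : g (Encodable.encode c) with
  | false => simpa [h] using h0 (Encodable.encode c) (by simp [hn, h])
  | true => simpa [h] using h1 (Encodable.encode c) (by simp [hn, h])

/-- For every computable linear order `L`, the ill-founded part of `L`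
is Σ¹₁ but not Σ¹₁-complete: some Σ¹₁ set is not many-one reducible to it. -/
theorem illPart_not_Sigma11_complete (L : LinOrd) (hL : ComputableLinOrd L) :
    Sigma11 (illPart L) ∧
      ∃ A : Set ℕ, Sigma11 A ∧
        ¬ ∃ h : ℕ → ℕ, Computable h ∧ ∀ n, n ∈ A ↔ h n ∈ illPart L := by
  refine ⟨sigma11_illPart hL, ?_⟩
  by_contra! hred
  obtain ⟨p, hp, hpI⟩ := hred _ (sigma11_self_output 0)
  obtain ⟨q, hq, hqI⟩ := hred _ (sigma11_self_output 1)
  obtain ⟨hv, ⟨δ, hδ, hdom⟩, χ, hχ, hlt⟩ := hL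
  have hg : Computable fun n => !δ (q n) || χ (q n) (p n) :=
    Computable₂.comp Primrec.or.to_comp (Primrec.not.to_comp.comp (hδ.comp hq)) (hχ.comp hq hp)
  have hdisj (n : ℕ) (h0 : 0 ∈ codeFn n n) (h1 : 1 ∈ codeFn n n) : False :=
    absurd (Part.mem_unique h0 h1) zero_ne_one
  refine not_computable_separation hg (fun n h0 => ?_) fun n h1 => ?_
  · have hpn := (hpI n).1 h0
    have hqn : q n ∉ illPart L := fun h => hdisj n h0 ((hqI n).2 h)
    by_cases hd : q n ∈ L.dom
    · rcases hv.2.2.2 _ hd _ (illPart_subset_dom L hpn) with h | h | h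
      · exact absurd (h ▸ hpn) hqn
      · simp [(hlt _ _).1 h]
      · exact absurd (mem_illPart_of_lt hv h hpn) hqn
    · simp [Bool.eq_false_iff.2 (mt (hdom _).2 hd)]
  · have hqn := (hqI n).1 h1
    have hnlt : ¬ L.lt (q n) (p n) := fun h =>
      hdisj n ((hpI n).2 (mem_illPart_of_lt hv h hqn)) h1
    simp [(hdom _).1 (illPart_subset_dom L hqn), Bool.eq_false_iff.2 (mt (hlt _ _).2 hnlt)]

end CFT
end

section
/- Every PA degree is loquaciously PA: if X ⊆ ℕ is such that every infinite computable binary tree has an X-computable infinite path, then there is a total X-computable F : ℕ × ℕ → ℕ taking values in {0,1} such that for every index e, whenever the e-th computable binary tree B_e is infinite, n ↦ F(e,n) is an infinite path through B_e. -/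
namespace CFT

open Nat.Partrec (Code)

/-- `X` is of PA degree: every infinite computable binary tree has an `X`-computable
infinite path. -/
def PADegree (X : Set ℕ) : Prop :=
  ∀ B : Set (List Bool), PrefixClosedB B →
    (∃ χ : List Bool → Bool, Computable χ ∧ ∀ l, l ∈ B ↔ χ l = true) →
    BInfinite B → ∃ p : ℕ → Bool, ComputableIn (chi X) p ∧ IsBPath B p

open Encodable Denumerable

/-! ### Closure properties of oracle computability -/

section Oracle

variable {O : ℕ → ℕ}

theorem RecursiveIn.of_partrec {f : ℕ →. ℕ} (hf : Nat.Partrec f) : RecursiveIn O f := by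
  induction hf with
  | zero => exact .zero
  | succ => exact .succ
  | left => exact .left
  | right => exact .right
  | pair _ _ ihf ihg => exact .pair ihf ihg
  | comp _ _ ihf ihg => exact .comp ihf ihg
  | prec _ _ ihf ihg => exact .prec ihf ihg
  | rfind _ ihf => exact .rfind ihf

theorem RecursiveIn.of_eq {f g : ℕ →. ℕ} (hf : RecursiveIn O f) (H : ∀ n, f n = g n) :
    RecursiveIn O g :=
  (funext H : f = g) ▸ hf

theorem RecursiveIn.of_primrec {f : ℕ → ℕ} (hf : Primrec f) : RecursiveIn O (f : ℕ →. ℕ) :=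
  .of_partrec (Partrec.nat_iff.1 hf.to_comp.partrec)

theorem RecursiveIn.total_comp {f g : ℕ → ℕ} (hf : RecursiveIn O (f : ℕ →. ℕ))
    (hg : RecursiveIn O (g : ℕ →. ℕ)) :
    RecursiveIn O ((fun n => f (g n) : ℕ → ℕ) : ℕ →. ℕ) := by
  refine (hf.comp hg).of_eq fun n => ?_
  exact Part.bind_some _ _

theorem RecursiveIn.total_pair {f g : ℕ → ℕ} (hf : RecursiveIn O (f : ℕ →. ℕ))
    (hg : RecursiveIn O (g : ℕ →. ℕ)) :
    RecursiveIn O ((fun n => Nat.pair (f n) (g n) : ℕ → ℕ) : ℕ →. ℕ) := by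
  refine (hf.pair hg).of_eq fun n => ?_
  simp [Seq.seq]

theorem RecursiveIn.total_prec {f g : ℕ → ℕ} (hf : RecursiveIn O (f : ℕ →. ℕ))
    (hg : RecursiveIn O (g : ℕ →. ℕ)) :
    RecursiveIn O ((fun m => m.unpair.2.rec (f m.unpair.1)
      fun y i => g (Nat.pair m.unpair.1 (Nat.pair y i)) : ℕ → ℕ) : ℕ →. ℕ) := by
  refine (hf.prec hg).of_eq fun m => ?_
  simp only [Nat.unpaired, PFun.coe_val]
  induction m.unpair.2 with
  | zero => rfl
  | succ y ih => simp_all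

theorem computableIn_nat_iff {α : Type} [Primcodable α] {f : ℕ → α} :
    ComputableIn O f ↔ RecursiveIn O ((fun n => encode (f n) : ℕ → ℕ) : ℕ →. ℕ) := by
  unfold ComputableIn PartrecIn
  refine iff_of_eq (congrArg _ (funext fun n => ?_))
  simp

theorem computableIn_nat_prod_iff {f : ℕ × ℕ → ℕ} :
    ComputableIn O f ↔ RecursiveIn O ((fun n => f n.unpair : ℕ → ℕ) : ℕ →. ℕ) := by
  unfold ComputableIn PartrecIn
  refine iff_of_eq (congrArg _ (funext fun n => ?_))
  simp

end Oracle

/-! ### Completing partial computable Boolean functions -/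

theorem evaln_eq_of_le {s t n x : ℕ} {c : Code} (hst : s ≤ t) (h : c.evaln s n = some x) :
    c.evaln t n = some x :=
  Code.evaln_mono hst h

/-- The tree of approximations to total extensions of the `Bool`-valued function coded by `c`. -/
def completionTree (c : Code) : Set (List Bool) :=
  {l | ∀ i < l.length, c.evaln l.length i = none ∨ c.evaln l.length i = l[i]?.map encode}

theorem prefixClosedB_completionTree (c : Code) : PrefixClosedB (completionTree c) := by
  intro l hl l' hpre i hi
  have hle := hpre.length_le
  rcases h : c.evaln l'.length i with _ | x
  · exact .inl rfl
  · have hx := evaln_eq_of_le hle h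
    have := hl i (hi.trans_le hle)
    rw [hx] at this
    rcases this with h0 | h1
    · cases h0
    · right
      rw [h1, List.prefix_iff_getElem?.1 hpre i hi, List.getElem?_eq_getElem hi]

theorem primrecPred_completionTree (c : Code) : PrimrecPred (· ∈ completionTree c) := by
  have hev : Primrec fun p : ℕ × List Bool => c.evaln p.2.length p.1 :=
    Code.primrec_evaln.comp (((Primrec.list_length.comp .snd).pair (.const c)).pair .fst)
  have hR : PrimrecRel fun (i : ℕ) (l : List Bool) =>
      c.evaln l.length i = none ∨ c.evaln l.length i = l[i]?.map encode :=
    (Primrec.eq.comp hev (.const none)).or (Primrec.eq.comp hev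
      (Primrec.option_map (Primrec.list_getElem?.comp .snd .fst) (Primrec.encode.comp .snd).to₂))
  exact (PrimrecRel.forall_mem_list hR).comp
    (Primrec.list_range.comp Primrec.list_length) Primrec.id |>.of_eq fun l => by
      simp [completionTree]

open Classical in
/-- A set of PA degree computes a total extension of every partial computable
`Bool`-valued function. -/
theorem PADegree.exists_total_extension {X : Set ℕ} (h : PADegree X) {α : Type} [Primcodable α]
    {f : α →. Bool} (hf : Partrec f) :
    ∃ p : ℕ → Bool, ComputableIn (chi X) p ∧ ∀ a, ∀ b ∈ f a, p (encode a) = b := by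
  obtain ⟨c, hc⟩ := Code.exists_code.1 hf
  have hmem (n x : ℕ) : x ∈ c.eval n ↔ ∃ a, decode n = some a ∧ ∃ b ∈ f a, encode b = x := by
    simp [hc]
  have hinf : BInfinite (completionTree c) := by
    intro k
    refine ⟨(List.range k).map fun i => decide (1 ∈ c.eval i), fun i hi => ?_, by simp⟩
    have hik : i < k := by simpa using hi
    rcases hx : c.evaln _ i with _ | x
    · exact .inl rfl
    · have hx := Code.evaln_sound hx
      obtain ⟨a, -, b, -, rfl⟩ := (hmem i x).1 hx
      rw [← Part.eq_some_iff] at hx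
      cases b <;> simp [hik, hx]
  obtain ⟨p, hp, hpath⟩ := h _ (prefixClosedB_completionTree c)
    ⟨fun l => decide (l ∈ completionTree c), (primrecPred_completionTree c).decide.to_comp,
      by simp⟩ hinf
  refine ⟨p, hp, fun a b hb => ?_⟩
  obtain ⟨s, hs⟩ := Code.evaln_complete.1 ((hmem (encode a) (encode b)).2 ⟨a, by simp, b, hb, rfl⟩)
  have hk := hpath (max s (encode a + 1)) (encode a) (by simp)
  rw [List.length_map, List.length_range, evaln_eq_of_le (le_max_left s _) hs] at hk
  simpa [eq_comm] using hk

/-! ### Recognizing strings with finitely many extensions -/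

/-- The list of all binary strings of length `k`. -/
def boolStrings (k : ℕ) : List (List Bool) :=
  k.rec [[]] fun _ L => L.flatMap fun l => [false :: l, true :: l]

theorem mem_boolStrings {k : ℕ} {l : List Bool} : l ∈ boolStrings k ↔ l.length = k := by
  induction k generalizing l with
  | zero => simp [boolStrings]
  | succ k ih =>
    change l ∈ (boolStrings k).flatMap _ ↔ _
    rcases l with _ | ⟨_ | _, l⟩ <;> simp [ih]

theorem primrec_boolStrings : Primrec boolStrings := by
  refine Primrec.nat_rec₁ [[]] ?_
  refine Primrec.list_flatMap .snd ?_
  exact Primrec.list_cons.comp (Primrec.list_cons.comp (.const false) .snd)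
    (Primrec.list_cons.comp (Primrec.list_cons.comp (.const true) .snd) (.const []))

/-- `s = ⟨k, t⟩` witnesses that no extension of `l` by `k` bits is in the tree decided by `e`:
all relevant computations halt within `t` steps and reject. -/
def Kills (e : ℕ) (l : List Bool) (s : ℕ) : Prop :=
  ∀ r ∈ boolStrings s.unpair.1,
    ¬ ((ofNat Code e).evaln s.unpair.2 (encode (l ++ r)) = none ∨
      (ofNat Code e).evaln s.unpair.2 (encode (l ++ r)) = some 1)

theorem primrecPred_kills : PrimrecPred fun p : (ℕ × List Bool) × ℕ => Kills p.1.1 p.1.2 p.2 := by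
  have hev : Primrec fun p : List Bool × (ℕ × List Bool) × ℕ =>
      (ofNat Code p.2.1.1).evaln p.2.2.unpair.2 (encode (p.2.1.2 ++ p.1)) :=
    Code.primrec_evaln.comp <|
      ((Primrec.snd.comp (Primrec.unpair.comp (Primrec.snd.comp .snd))).pair
        ((Primrec.ofNat Code).comp (Primrec.fst.comp (Primrec.fst.comp .snd)))).pair
      (Primrec.encode.comp
        (Primrec.list_append.comp (Primrec.snd.comp (Primrec.fst.comp .snd)) .fst))
  have hR : PrimrecRel fun (r : List Bool) (p : (ℕ × List Bool) × ℕ) =>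
      ¬ ((ofNat Code p.1.1).evaln p.2.unpair.2 (encode (p.1.2 ++ r)) = none ∨
        (ofNat Code p.1.1).evaln p.2.unpair.2 (encode (p.1.2 ++ r)) = some 1) :=
    ((Primrec.eq.comp hev (.const none)).or (Primrec.eq.comp hev (.const (some 1)))).not
  exact hR.forall_mem_list.comp
    (primrec_boolStrings.comp (Primrec.fst.comp (Primrec.unpair.comp .snd))) Primrec.id

theorem Kills.codeFn_ne {e s : ℕ} {l r : List Bool} (h : Kills e l s)
    (hr : r.length = s.unpair.1) : codeFn e (encode (l ++ r)) ≠ Part.some 1 := by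
  intro h1
  have h2 := h r (mem_boolStrings.2 hr)
  rcases hx : (ofNat Code e).evaln s.unpair.2 (encode (l ++ r)) with _ | x
  · simp [hx] at h2
  · have := Code.evaln_sound hx
    rw [show (ofNat Code e).eval (encode (l ++ r)) = Part.some 1 from h1] at this
    simp [hx, Part.mem_some_iff.1 this] at h2

theorem exists_kills {e k : ℕ} {l : List Bool} (htot : ∀ n, (codeFn e n).Dom)
    (h : ∀ r : List Bool, r.length = k → codeFn e (encode (l ++ r)) ≠ Part.some 1) :
    ∃ s, Kills e l s := by
  have hall (r : List Bool) : ∃ t, (ofNat Code e).evaln t (encode (l ++ r)) ≠ none := by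
    obtain ⟨t, ht⟩ := Code.evaln_complete.1 (Part.get_mem (htot (encode (l ++ r))))
    exact ⟨t, by simp [Option.mem_def.1 ht]⟩
  choose t ht using hall
  refine ⟨Nat.pair k ((boolStrings k).map t).sum, fun r hr => ?_⟩
  simp only [Nat.unpair_pair] at hr ⊢
  rintro (h0 | h1)
  · obtain ⟨x, hx⟩ := Option.ne_none_iff_exists'.1 (ht r)
    rw [evaln_eq_of_le (List.le_sum_of_mem (List.mem_map_of_mem hr)) hx] at h0
    cases h0
  · exact h r (mem_boolStrings.1 hr) (Part.eq_some_iff.2 (Code.evaln_sound h1))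

open Classical in
/-- Search for a proof that one of the two immediate successors of a string has only finitely
many extensions in the `e`-th tree, and return the last bit of the other one. -/
noncomputable def safeBit (a : ℕ × List Bool) : Part Bool :=
  Nat.rfindOpt fun s =>
    if Kills a.1 (a.2 ++ [false]) s then some true
    else if Kills a.1 (a.2 ++ [true]) s then some false else none

open Classical in
theorem partrec_safeBit : Partrec safeBit := by
  have hK (b : Bool) :
      PrimrecPred fun p : (ℕ × List Bool) × ℕ => Kills p.1.1 (p.1.2 ++ [b]) p.2 :=
    primrecPred_kills.comp (((Primrec.fst.comp .fst).pair
      (Primrec.list_append.comp (Primrec.snd.comp .fst) (.const [b]))).pair .snd)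
  exact Partrec.rfindOpt (Primrec.to_comp (Primrec.ite (hK false) (.const (some true))
    (Primrec.ite (hK true) (.const (some false)) (.const none))))

theorem exists_kills_of_mem_safeBit {e : ℕ} {l : List Bool} {b : Bool} (h : b ∈ safeBit (e, l)) :
    ∃ s, Kills e (l ++ [!b]) s := by
  obtain ⟨s, hs⟩ := Nat.rfindOpt_spec h
  refine ⟨s, ?_⟩
  dsimp only at hs
  split_ifs at hs with h0 h1 <;> simp at hs <;> subst hs <;> assumption

theorem safeBit_dom_of_kills {e s : ℕ} {l : List Bool} {b : Bool} (h : Kills e (l ++ [b]) s) :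
    (safeBit (e, l)).Dom := by
  refine Nat.rfindOpt_dom.2 ⟨s, ?_⟩
  by_cases h0 : Kills e (l ++ [false]) s
  · exact ⟨true, by simp [h0]⟩
  · cases b
    · exact absurd h h0
    · exact ⟨false, by simp [h0, h]⟩

/-! ### Following safe bits -/

/-- The string of length `n` obtained in the `e`-th tree by following the choice function `p`. -/
def follow (p : ℕ → Bool) (e : ℕ) : ℕ → List Bool
  | 0 => []
  | n + 1 => follow p e n ++ [p (encode (e, follow p e n))]

theorem follow_eq_map_range (p : ℕ → Bool) (e k : ℕ) :
    follow p e k = (List.range k).map fun n => p (encode (e, follow p e n)) := by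
  induction k with
  | zero => rfl
  | succ k ih => rw [List.range_succ, List.map_append, ← ih]; rfl

theorem recursiveIn_follow {O : ℕ → ℕ} {p : ℕ → Bool}
    (hp : RecursiveIn O ((fun n => encode (p n) : ℕ → ℕ) : ℕ →. ℕ)) :
    RecursiveIn O ((fun m => encode (follow p m.unpair.1 m.unpair.2) : ℕ → ℕ) : ℕ →. ℕ) := by
  have happ : Primrec fun m : ℕ => encode
      (((decode m.unpair.1 : Option (List Bool)).getD []) ++ [decide (m.unpair.2 = 1)]) := by
    refine Primrec.encode.comp (Primrec.list_append.comp
      (Primrec.option_getD.comp (Primrec.decode.comp (Primrec.fst.comp .unpair)) (.const []))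
      (Primrec.list_cons.comp ?_ (.const [])))
    exact (Primrec.eq.comp (Primrec.snd.comp .unpair) (.const 1)).decide
  have hi : Primrec fun m : ℕ => m.unpair.2.unpair.2 :=
    Primrec.snd.comp (Primrec.unpair.comp (Primrec.snd.comp .unpair))
  have hei : Primrec fun m : ℕ => Nat.pair m.unpair.1 m.unpair.2.unpair.2 :=
    Primrec₂.natPair.comp (Primrec.fst.comp .unpair) hi
  have hstep := (RecursiveIn.of_primrec happ).total_comp
    ((RecursiveIn.of_primrec hi).total_pair (hp.total_comp (.of_primrec hei)))
  convert (RecursiveIn.of_primrec (Primrec.const 0)).total_prec hstep using 3 with m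
  induction m.unpair.2 with
  | zero => rfl
  | succ n ih =>
    simp only [Nat.unpair_pair] at ih ⊢
    rw [← ih]
    simp only [follow, encodek, Option.getD_some, encode_prod_val, encode_nat]
    cases p _ <;> rfl

/-- The string `l` has extensions of every length in the tree decided by `e`. -/
def Extendible (e : ℕ) (l : List Bool) : Prop :=
  ∀ k, ∃ r : List Bool, r.length = k ∧ codeFn e (encode (l ++ r)) = Part.some 1

theorem Extendible.not_kills {e s : ℕ} {l : List Bool} (h : Extendible e l) : ¬ Kills e l s := by
  intro hs
  obtain ⟨r, hr, h1⟩ := h s.unpair.1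
  exact hs.codeFn_ne hr h1

theorem exists_kills_of_not_extendible {e : ℕ} {l : List Bool} (htot : ∀ n, (codeFn e n).Dom)
    (h : ¬ Extendible e l) : ∃ s, Kills e l s := by
  simp only [Extendible, not_forall, not_exists, not_and] at h
  obtain ⟨k, hk⟩ := h
  exact exists_kills htot hk

theorem Extendible.exists_bit {e : ℕ} {l : List Bool} (hdec : DecidesBTree e)
    (h : Extendible e l) : ∃ b, Extendible e (l ++ [b]) := by
  by_contra! hno
  have h' (b : Bool) : ∃ k, ∀ r : List Bool, r.length = k →
      codeFn e (encode (l ++ b :: r)) ≠ Part.some 1 := by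
    simpa [Extendible] using hno b
  choose k hk using h'
  obtain ⟨r, hr, h1⟩ := h (k false + k true + 1)
  rcases r with _ | ⟨b, r⟩
  · simp at hr
  · have hkb : k b ≤ r.length := by
      simp only [List.length_cons] at hr
      cases b <;> omega
    refine hk b (r.take (k b)) (by simpa using hkb) (hdec.2 _ h1 _ ?_)
    simpa using List.take_prefix _ _

theorem Extendible.concat_of_extends_safeBit {e : ℕ} {l : List Bool} (hdec : DecidesBTree e)
    (h : Extendible e l) {b : Bool} (hb : ∀ b' ∈ safeBit (e, l), b = b') :
    Extendible e (l ++ [b]) := by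
  by_contra hno
  obtain ⟨s, hs⟩ := exists_kills_of_not_extendible hdec.1 hno
  obtain ⟨b', hb'⟩ := Part.dom_iff_mem.1 (safeBit_dom_of_kills hs)
  obtain rfl := hb b' hb'
  obtain ⟨t, ht⟩ := exists_kills_of_mem_safeBit hb'
  obtain ⟨d, hd⟩ := h.exists_bit hdec
  rcases Bool.eq_or_eq_not d b with rfl | rfl
  · exact hno hd
  · exact hd.not_kills ht

theorem extendible_follow {e : ℕ} {p : ℕ → Bool} (hdec : DecidesBTree e)
    (h : Extendible e []) (hp : ∀ a, ∀ b ∈ safeBit a, p (encode a) = b) (n : ℕ) :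
    Extendible e (follow p e n) := by
  induction n with
  | zero => exact h
  | succ n ih => exact ih.concat_of_extends_safeBit hdec (hp _)

/-- Every PA degree is loquaciously PA: there is a total `X`-computable
`{0,1}`-valued `F : ℕ × ℕ → ℕ` such that whenever the `e`-th computable binary tree is
infinite, `n ↦ F (e, n)` is an infinite path through it. -/
theorem pa_implies_loquaciously_pa (X : Set ℕ) (h : PADegree X) :
    ∃ F : ℕ × ℕ → ℕ, ComputableIn (chi X) F ∧ (∀ p, F p ≤ 1) ∧
      ∀ e, BInfinite (bTreeAt e) →
        IsBPath (bTreeAt e) fun n => decide (F (e, n) = 1) := by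
  obtain ⟨p, hp, hext⟩ := h.exists_total_extension partrec_safeBit
  have hp' := computableIn_nat_iff.1 hp
  refine ⟨fun a => encode (p (encode (a.1, follow p a.1 a.2))), ?_, ?_, ?_⟩
  · refine computableIn_nat_prod_iff.2 ?_
    exact hp'.total_comp
      ((RecursiveIn.left (O := chi X)).total_pair (recursiveIn_follow hp'))
  · intro a
    dsimp only
    cases p (encode (a.1, follow p a.1 a.2)) <;> decide
  · intro e hinf k
    have hpath : ((List.range k).map fun n => decide (encode (p (encode (e, follow p e n))) = 1)) =
        follow p e k := by
      rw [follow_eq_map_range]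
      refine congrArg (fun f => (List.range k).map f) (funext fun n => ?_)
      cases p (encode (e, follow p e n)) <;> rfl
    simp only [hpath]
    by_cases hdec : DecidesBTree e
    · simp only [bTreeAt, if_pos hdec] at hinf ⊢
      have h0 : Extendible e [] := fun k => by
        obtain ⟨l, hl, hk⟩ := hinf k
        exact ⟨l, hk, hl⟩
      obtain ⟨r, hr, h1⟩ := extendible_follow hdec h0 hext k 0
      simpa [List.length_eq_zero_iff.1 hr] using h1
    · simp [bTreeAt, hdec]

end CFT
end
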